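/- Let d, T ≥ 1, λ > 0, let φ₁, …, φ_T ∈ ℝ^d satisfy ‖φ_t‖₂ ≤ 1 for all t, and define Λ_t = λ·I_d + Σ_{ι=1}^{t} φ_ι φ_ι^⊤ for 0 ≤ t ≤ T. Then Σ_{t=1}^{T} min{ φ_t^⊤ Λ_{t−1}^{−1} φ_t , 1 } ≤ 2·d·log(1 + T/(d·λ)). -/

import Mathlib

open Finset Real Matrix

lemma Real.min_one_le_two_mul_log_one_add {x : ℝ} (hx : 0 ≤ x) :
    min x 1 ≤ 2 * Real.log (1 + x) := by
  have h := Real.le_log_one_add_of_nonneg hx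
  have h' : min x 1 / 2 ≤ 2 * x / (x + 2) := by
    rw [div_le_div_iff₀ (by norm_num) (by linarith)]
    rcases le_total x 1 with hx1 | hx1
    · rw [min_eq_left hx1]; nlinarith
    · rw [min_eq_right hx1]; linarith
  linarith

namespace Matrix

variable {n : Type*} [Fintype n] [DecidableEq n]

lemma det_add_vecMulVec {R : Type*} [CommRing R] {A : Matrix n n R} (hA : IsUnit A.det)
    (u v : n → R) :
    (A + vecMulVec u v).det = A.det * (1 + v ⬝ᵥ A⁻¹ *ᵥ u) := by
  rw [vecMulVec_eq Unit, det_add_replicateCol_mul_replicateRow hA, Matrix.mul_assoc]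
  simp [Matrix.mul_apply, dotProduct, mulVec]

/-- Determinant–trace inequality, linearized at an arbitrary `m > 0`. -/
lemma PosDef.log_det_le {A : Matrix n n ℝ} (hA : A.PosDef) {m : ℝ} (hm : 0 < m) :
    Real.log A.det ≤ Fintype.card n * Real.log m + (A.trace / m - Fintype.card n) := by
  have h_det : A.det = ∏ i, hA.1.eigenvalues i := by simpa using hA.1.det_eq_prod_eigenvalues
  have h_trace : A.trace = ∑ i, hA.1.eigenvalues i := by
    simpa using hA.1.trace_eq_sum_eigenvalues
  rw [h_det, h_trace, Real.log_prod fun i _ => (hA.eigenvalues_pos i).ne']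
  calc ∑ i, Real.log (hA.1.eigenvalues i)
      ≤ ∑ i, (Real.log m + (hA.1.eigenvalues i / m - 1)) := by
        refine Finset.sum_le_sum fun i _ => ?_
        have h := Real.log_le_sub_one_of_pos (div_pos (hA.eigenvalues_pos i) hm)
        rw [Real.log_div (hA.eigenvalues_pos i).ne' hm.ne'] at h
        linarith
    _ = _ := by
        simp [Finset.sum_add_distrib, Finset.sum_sub_distrib, Finset.sum_div]

/-- One step of the elliptical potential argument. -/
lemma PosDef.min_one_le_log_det_sub {A : Matrix n n ℝ} (hA : A.PosDef) (v : n → ℝ) :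
    min (v ⬝ᵥ A⁻¹ *ᵥ v) 1 ≤
      2 * (Real.log (A + vecMulVec v v).det - Real.log A.det) := by
  have hv : 0 ≤ v ⬝ᵥ A⁻¹ *ᵥ v := by
    simpa using hA.inv.posSemidef.dotProduct_mulVec_nonneg v
  rw [det_add_vecMulVec hA.det_pos.ne'.isUnit,
    Real.log_mul hA.det_pos.ne' (by linarith), add_sub_cancel_left]
  exact Real.min_one_le_two_mul_log_one_add hv

end Matrix

/-- Elliptical potential bound with regularization `λ·I`: with `Λ_t = λ I + ∑_{ι=1}^t φ_ι φ_ι^⊤`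
and `‖φ_t‖₂ ≤ 1`, one has
`∑_{t=1}^T min (φ_t^⊤ Λ_{t−1}⁻¹ φ_t) 1 ≤ 2 d log (1 + T / (d λ))`. -/
theorem elliptical_potential_log_bound
    {d : ℕ} (hd : 1 ≤ d) (T : ℕ) (hT : 1 ≤ T) (lam : ℝ) (hlam : 0 < lam)
    (φ : ℕ → Fin d → ℝ)
    (hφ : ∀ t ∈ Finset.Icc 1 T, Real.sqrt (∑ i, (φ t i) ^ 2) ≤ 1)
    (Λ : ℕ → Matrix (Fin d) (Fin d) ℝ)
    (hΛ : ∀ t, Λ t = lam • (1 : Matrix (Fin d) (Fin d) ℝ)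
        + ∑ ι ∈ Finset.Icc 1 t, Matrix.vecMulVec (φ ι) (φ ι)) :
    ∑ t ∈ Finset.Icc 1 T,
        min (dotProduct (φ t) ((Λ (t - 1))⁻¹.mulVec (φ t))) 1
      ≤ 2 * d * Real.log (1 + T / (d * lam)) := by
  have h_zero : Λ 0 = lam • (1 : Matrix (Fin d) (Fin d) ℝ) := by simp [hΛ]
  have h_succ (t : ℕ) : Λ (t + 1) = Λ t + vecMulVec (φ (t + 1)) (φ (t + 1)) := by
    rw [hΛ, hΛ, Finset.sum_Icc_succ_top (by omega), add_assoc]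
  have h_pos (t : ℕ) : (Λ t).PosDef := by
    rw [hΛ]
    refine (PosDef.one.smul hlam).add_posSemidef (posSemidef_sum _ fun ι _ => ?_)
    simpa using posSemidef_vecMulVec_self_star (φ ι)
  have h_potential (N : ℕ) :
      ∑ t ∈ Finset.Icc 1 N, min (φ t ⬝ᵥ (Λ (t - 1))⁻¹ *ᵥ φ t) 1
        ≤ 2 * (Real.log (Λ N).det - Real.log (Λ 0).det) := by
    induction N with
    | zero => simp
    | succ N ih =>
      have h := (h_pos N).min_one_le_log_det_sub (φ (N + 1))
      rw [← h_succ] at h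
      rw [Finset.sum_Icc_succ_top (by omega), Nat.add_sub_cancel]
      linarith
  have h_trace : (Λ T).trace ≤ d * lam + T := by
    rw [hΛ, trace_add, trace_smul, trace_one, trace_sum, Fintype.card_fin, smul_eq_mul,
      mul_comm lam]
    gcongr
    calc ∑ t ∈ Finset.Icc 1 T, (vecMulVec (φ t) (φ t)).trace
        ≤ ∑ t ∈ Finset.Icc 1 T, (1 : ℝ) := by
          refine Finset.sum_le_sum fun t ht => ?_
          have h := Real.sqrt_le_one.mp (hφ t ht)
          simpa [trace_vecMulVec, dotProduct, sq] using h
      _ = T := by simp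
  have hd_pos : (0 : ℝ) < d := by exact_mod_cast hd
  have hr : 0 < 1 + T / (d * lam) := by positivity
  have h_det := (h_pos T).log_det_le (mul_pos hlam hr)
  have h_ratio : (Λ T).trace / (lam * (1 + T / (d * lam))) ≤ d := by
    rw [div_le_iff₀ (mul_pos hlam hr)]
    refine h_trace.trans_eq ?_
    field_simp
  have h_det_zero : Real.log (Λ 0).det = d * Real.log lam := by simp [h_zero]
  rw [Real.log_mul hlam.ne' hr.ne', Fintype.card_fin] at h_det
  have h := h_potential T
  rw [h_det_zero] at h
  linarith
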